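/- arXiv:2402.13601 — 2 statements merged into one kernel-verified Lean document; each statement's English description precedes it below -/
import Mathlib

section
/- A graph G has a strong parity factor if and only if c(G−S) ≤ Σ_{v∈S} d_G(v) − 2|S| + 1 for every subset S ⊆ V(G). -/
open Finset

/-- A graph `G` contains a strong parity factor if for every subset `X ⊆ V(G)` with `|X|`
even, `G` has a spanning subgraph `F` with minimum degree at least 1 whose degrees are odd
exactly on `X`. -/
def HasStrongParityFactor {V : Type*} [Fintype V] (G : SimpleGraph V) : Prop :=
  ∀ X : Finset V, Even X.card →
    ∃ F : SimpleGraph V, F ≤ G ∧ (∀ v : V, 1 ≤ (F.neighborSet v).ncard) ∧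
      (∀ u ∈ X, Odd (F.neighborSet u).ncard) ∧
      (∀ v : V, v ∉ X → Even (F.neighborSet v).ncard)

open SimpleGraph in
theorem aux_even_degree_sum {V : Type*} [Fintype V] (G : SimpleGraph V) :
    Even (∑ v, (G.neighborSet v).ncard) := by
  classical
  have h := G.sum_degrees_eq_twice_card_edges
  have : ∀ v, (G.neighborSet v).ncard = G.degree v := fun v => by
    rw [Set.ncard_eq_toFinset_card']; rfl
  simp only [this, h]
  exact even_two_mul _

theorem aux_sdiff {V : Type*} [Fintype V] {G F : SimpleGraph V} (h : F ≤ G) (v : V) :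
    ((G \ F).neighborSet v).ncard + (F.neighborSet v).ncard = (G.neighborSet v).ncard := by
  have h1 : (G \ F).neighborSet v = G.neighborSet v \ F.neighborSet v := by
    ext w; simp
  rw [h1]
  exact Set.ncard_sdiff_add_ncard_of_subset (fun w hw => h hw)

theorem aux_leave {V : Type*} [Fintype V] (H : SimpleGraph V) (C : Finset V)
    (hC : Odd (∑ v ∈ C, (H.neighborSet v).ncard)) :
    ∃ v ∈ C, ∃ w, w ∉ C ∧ H.Adj v w := by
  classical
  by_contra hcon
  push Not at hcon
  let K : SimpleGraph V :=
    { Adj := fun u v => H.Adj u v ∧ u ∈ C ∧ v ∈ C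
      symm := ⟨fun u v h => ⟨h.1.symm, h.2.2, h.2.1⟩⟩
      loopless := ⟨fun u h => H.loopless.irrefl u h.1⟩ }
  have hK := aux_even_degree_sum K
  have h2 : ∑ v, (K.neighborSet v).ncard = ∑ v ∈ C, (H.neighborSet v).ncard := by
    rw [← Finset.sum_subset (Finset.subset_univ C)]
    · refine Finset.sum_congr rfl fun v hv => ?_
      congr 1
      ext w
      simp only [SimpleGraph.mem_neighborSet, K]
      constructor
      · exact fun h => h.1
      · intro h
        refine ⟨h, hv, ?_⟩
        by_contra hw
        exact hcon v hv w hw h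
    · intro v _ hv
      have : K.neighborSet v = ∅ := by
        ext w
        simp [SimpleGraph.mem_neighborSet, K, hv]
      simp [this]
  rw [h2] at hK
  exact (Nat.not_even_iff_odd.mpr hC) hK

/-- The blow-up of `G` in which `v` is replaced by a clique on `f v` vertices. -/
def auxBlow {V : Type*} (G : SimpleGraph V) (f : V → ℕ) : SimpleGraph (Σ v : V, Fin (f v)) where
  Adj x y := x ≠ y ∧ (x.1 = y.1 ∨ G.Adj x.1 y.1)
  symm := ⟨fun _ _ h => ⟨h.1.symm, h.2.imp (fun e => e.symm) (fun e => G.adj_symm e)⟩⟩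
  loopless := ⟨fun _ h => h.1 rfl⟩

theorem auxBlow_adj {V : Type*} (G : SimpleGraph V) (f : V → ℕ) (x y : Σ v : V, Fin (f v)) :
    (auxBlow G f).Adj x y ↔ x ≠ y ∧ (x.1 = y.1 ∨ G.Adj x.1 y.1) := Iff.rfl

theorem aux_of_matching {V : Type*} [Fintype V] (G : SimpleGraph V) (f : V → ℕ)
    (hM : ∃ M : (auxBlow G f).Subgraph, M.IsPerfectMatching) :
    ∃ H : SimpleGraph V, H ≤ G ∧ ∀ v, (H.neighborSet v).ncard ≤ f v ∧
      (Odd (H.neighborSet v).ncard ↔ Odd (f v)) := by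
  classical
  obtain ⟨M, hM⟩ := hM
  rw [SimpleGraph.Subgraph.isPerfectMatching_iff] at hM
  choose p hp hpu using hM
  have hpp : ∀ x, p (p x) = x := fun x => (hpu (p x) x (hp x).symm).symm
  have hpne : ∀ x, p x ≠ x := fun x h => (hp x).ne h.symm
  let m : V → V → Finset (Σ v : V, Fin (f v)) := fun u v =>
    Finset.univ.filter fun x => x.1 = u ∧ (p x).1 = v
  have hmsymm : ∀ u v, (m u v).card = (m v u).card := by
    intro u v
    refine Finset.card_bij' (fun x _ => p x) (fun x _ => p x) ?_ ?_ ?_ ?_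
    · intro x hx; simp only [m, Finset.mem_filter, Finset.mem_univ, true_and, hpp] at hx ⊢
      exact ⟨hx.2, hx.1⟩
    · intro x hx; simp only [m, Finset.mem_filter, Finset.mem_univ, true_and, hpp] at hx ⊢
      exact ⟨hx.2, hx.1⟩
    · intro x _; exact hpp x
    · intro x _; exact hpp x
  have hmself : ∀ u, Even (m u u).card := by
    intro u
    have h0 : ∑ x ∈ m u u, (1 : ZMod 2) = 0 := by
      refine Finset.sum_involution (fun x _ => p x) ?_ ?_ ?_ ?_
      · intro x _; decide
      · intro x _ _; exact hpne x
      · intro x hx; simp only [m, Finset.mem_filter, Finset.mem_univ, true_and, hpp] at hx ⊢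
        exact ⟨hx.2, hx.1⟩
      · intro x _; exact hpp x
    rw [Finset.sum_const, nsmul_eq_mul, mul_one] at h0
    exact (ZMod.natCast_eq_zero_iff_even).mp h0
  have hmsum : ∀ u, ∑ v, (m u v).card = f u := by
    intro u
    have h1 : (Finset.univ.filter fun x : (Σ v : V, Fin (f v)) => x.1 = u).card = f u := by
      have : (Finset.univ.filter fun x : (Σ v : V, Fin (f v)) => x.1 = u)
          = Finset.univ.map ⟨fun i : Fin (f u) => (⟨u, i⟩ : Σ v : V, Fin (f v)),
              fun i j h => by simpa using h⟩ := by
        ext ⟨v, i⟩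
        simp only [Finset.mem_filter, Finset.mem_univ, true_and, Finset.mem_map,
          Function.Embedding.coeFn_mk]
        constructor
        · rintro rfl; exact ⟨i, rfl⟩
        · rintro ⟨j, hj⟩; exact (congrArg Sigma.fst hj).symm
      rw [this, Finset.card_map, Finset.card_univ, Fintype.card_fin]
    rw [← h1, Finset.card_eq_sum_card_fiberwise (f := fun x => (p x).1) (t := Finset.univ)
      (fun _ _ => Finset.mem_coe.mpr (Finset.mem_univ _))]
    refine Finset.sum_congr rfl fun v _ => ?_
    rw [Finset.filter_filter]
  let H : SimpleGraph V :=
    { Adj := fun u v => Odd (m u v).card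
      symm := ⟨fun u v h => by rw [hmsymm]; exact h⟩
      loopless := ⟨fun u h => (Nat.not_even_iff_odd.mpr h) (hmself u)⟩ }
  have hd : ∀ u, (H.neighborSet u).ncard = (Finset.univ.filter fun v => Odd (m u v).card).card := by
    intro u
    rw [← Set.ncard_coe_finset]
    congr 1
    ext v
    simp [H]
  refine ⟨H, ?_, ?_⟩
  · intro u v huv
    have hne := huv.ne
    have hodd : Odd (m u v).card := huv
    obtain ⟨x, hx⟩ := Finset.card_pos.mp hodd.pos
    simp only [m, Finset.mem_filter, Finset.mem_univ, true_and] at hx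
    obtain ⟨rfl, rfl⟩ := hx
    rcases ((auxBlow_adj G f _ _).mp (hp x).adj_sub).2 with h | h
    · exact absurd h hne
    · exact h
  · intro u
    rw [hd]
    constructor
    · rw [← hmsum u, Finset.card_filter]
      refine Finset.sum_le_sum fun v _ => ?_
      split_ifs with h
      · exact h.pos
      · exact Nat.zero_le _
    · rw [← hmsum u, Finset.odd_sum_iff_odd_card_odd]

theorem aux_tutte {V : Type*} [Fintype V] (G : SimpleGraph V) (f : V → ℕ)
    (heven : Even (∑ v, f v))
    (hS : ∀ S : Finset V, Nat.card (G.induce ((S : Set V)ᶜ)).ConnectedComponent ≤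
      ∑ v ∈ S, f v + 1) :
    ∃ M : (auxBlow G f).Subgraph, M.IsPerfectMatching := by
  classical
  rw [SimpleGraph.tutte]
  intro U hU
  unfold SimpleGraph.IsTutteViolator at hU
  set D := ((⊤ : (auxBlow G f).Subgraph).deleteVerts U) with hD
  have hDv : D.verts = Uᶜ := by
    rw [hD, SimpleGraph.Subgraph.deleteVerts_verts]; simp [Set.compl_eq_univ_sdiff]
  have hDmem : ∀ x, x ∈ D.verts ↔ x ∉ U := fun x => by rw [hDv]; rfl
  have hDadj : ∀ x y : D.verts, (auxBlow G f).Adj x y → D.coe.Adj x y := by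
    intro x y h
    rw [SimpleGraph.Subgraph.coe_adj]
    refine SimpleGraph.Subgraph.deleteVerts_adj.mpr ?_
    exact ⟨trivial, (hDmem _).mp x.2, trivial, (hDmem _).mp y.2, h⟩
  have hpar := D.coe.odd_ncard_oddComponents
  have hcard : Nat.card D.verts + U.ncard = ∑ v, f v := by
    rw [Nat.card_coe_set_eq, hDv, add_comm, Set.ncard_add_ncard_compl]
    simp
  have hle : D.coe.oddComponents.ncard ≤ Nat.card D.coe.ConnectedComponent :=
    Set.ncard_le_card _
  let S : Finset V := Finset.univ.filter fun v => ∀ i : Fin (f v), (⟨v, i⟩ : Σ v, Fin (f v)) ∈ U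
  have hSU : ∑ v ∈ S, f v ≤ U.ncard := by
    have : (S.sigma fun v => (Finset.univ : Finset (Fin (f v)))).card = ∑ v ∈ S, f v := by
      simp [Finset.card_sigma]
    rw [← this, ← Set.ncard_coe_finset]
    refine Set.ncard_le_ncard ?_ (Set.toFinite _)
    rintro ⟨v, i⟩ hx
    simp only [Finset.coe_sigma, Set.mem_sigma_iff] at hx
    have := hx.1
    simp only [S, Finset.coe_filter, Finset.mem_univ, true_and, Set.mem_ofPred_eq] at this
    exact this i
  have hex : ∀ v : ((S : Set V)ᶜ : Set V), ∃ i : Fin (f v), (⟨v, i⟩ : Σ v, Fin (f v)) ∉ U := by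
    rintro ⟨v, hv⟩
    simpa [S] using hv
  choose g hg using hex
  let φ : G.induce ((S : Set V)ᶜ) →g D.coe :=
    { toFun := fun v => ⟨⟨v, g v⟩, (hDmem _).mpr (hg v)⟩
      map_rel' := by
        intro a b hab
        have hab' : G.Adj a b := hab
        refine hDadj _ _ ((auxBlow_adj G f _ _).mpr ⟨?_, Or.inr hab'⟩)
        intro h
        exact hab'.ne (congrArg Sigma.fst h) }
  have hsurj : Function.Surjective (SimpleGraph.ConnectedComponent.map φ) := by
    intro c
    induction c using SimpleGraph.ConnectedComponent.ind with
    | h x =>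
      obtain ⟨⟨v, i⟩, hx⟩ := x
      have hvS : v ∈ ((S : Set V)ᶜ : Set V) := by
        have := (hDmem _).mp hx
        simp only [S, Set.mem_compl_iff, Finset.mem_coe, Finset.mem_filter, Finset.mem_univ,
          true_and, not_forall]
        exact ⟨i, this⟩
      refine ⟨SimpleGraph.connectedComponentMk _ ⟨v, hvS⟩, ?_⟩
      rw [SimpleGraph.ConnectedComponent.map_mk, SimpleGraph.ConnectedComponent.eq]
      by_cases h : (φ ⟨v, hvS⟩) = ⟨⟨v, i⟩, hx⟩
      · rw [h]
      · apply SimpleGraph.Adj.reachable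
        apply hDadj
        refine (auxBlow_adj G f _ _).mpr ⟨?_, Or.inl rfl⟩
        intro h'
        exact h (Subtype.ext h')
  have hcc := Nat.card_le_card_of_surjective _ hsurj
  have h3 := hS S
  have h4 : D.coe.oddComponents.ncard = U.ncard + 1 := by omega
  rw [h4] at hpar
  rw [← hcard] at heven
  rcases Nat.even_or_odd U.ncard with h | h
  · have := hpar.mp h.add_one
    rw [Nat.even_add] at heven
    exact (Nat.not_even_iff_odd.mpr this) (heven.mpr h)
  · rw [Nat.even_add] at heven
    have h5 : Odd (Nat.card D.verts) := by
      rw [← Nat.not_even_iff_odd, heven, Nat.not_even_iff_odd]; exact h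
    have := hpar.mpr h5
    exact (Nat.not_even_iff_odd.mpr this) h.add_one

theorem aux_suff {V : Type*} [Fintype V] (G : SimpleGraph V)
    (h : ∀ S : Finset V,
        (Nat.card (G.induce ((S : Set V)ᶜ)).ConnectedComponent : ℤ) ≤
          ∑ v ∈ S, ((G.neighborSet v).ncard : ℤ) - 2 * S.card + 1) :
    HasStrongParityFactor G := by
  classical
  intro X hX
  have hdeg : ∀ v, 2 ≤ (G.neighborSet v).ncard := by
    intro v
    have h1 := h {v}
    simp only [Finset.sum_singleton, Finset.card_singleton] at h1
    by_contra hlt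
    have h0 : Nat.card (G.induce ((({v} : Finset V) : Set V)ᶜ)).ConnectedComponent = 0 := by
      omega
    have h2 : (G.neighborSet v).ncard = 1 := by omega
    obtain ⟨w, hw⟩ := Set.ncard_eq_one.mp h2
    have hvw : G.Adj v w := by
      have : w ∈ G.neighborSet v := by rw [hw]; rfl
      exact this
    have hwm : w ∈ ((({v} : Finset V) : Set V)ᶜ) := by
      simpa using hvw.ne'
    have : Nonempty (G.induce ((({v} : Finset V) : Set V)ᶜ)).ConnectedComponent :=
      ⟨SimpleGraph.connectedComponentMk _ ⟨w, hwm⟩⟩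
    exact Nat.card_pos.ne' h0
  let f : V → ℕ := fun v => if v ∈ X then (G.neighborSet v).ncard - 1
    else (G.neighborSet v).ncard - 2
  have hf1 : ∀ v, f v + (2 - if v ∈ X then 1 else 0) = (G.neighborSet v).ncard := by
    intro v
    have := hdeg v
    simp only [f]
    split_ifs <;> omega
  have hf2 : ∀ v, (G.neighborSet v).ncard ≤ f v + 2 := by
    intro v
    simp only [f]
    split_ifs <;> omega
  have heven : Even (∑ v, f v) := by
    have h1 := aux_even_degree_sum G
    have h2 : ∑ v, f v + 2 * Fintype.card V = ∑ v, (G.neighborSet v).ncard + X.card := by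
      have : X.card = ∑ v, if v ∈ X then 1 else 0 := by simp
      rw [this, ← Finset.sum_add_distrib, ← Finset.card_univ, mul_comm, ← smul_eq_mul,
        ← Finset.sum_const, ← Finset.sum_add_distrib]
      refine Finset.sum_congr rfl fun v _ => ?_
      have := hf1 v
      split_ifs at this ⊢ <;> omega
    have h3 : Even (∑ v, f v + 2 * Fintype.card V) := by rw [h2]; exact h1.add hX
    rw [Nat.even_add] at h3
    exact h3.mpr (even_two_mul _)
  obtain ⟨H, hHG, hH⟩ := aux_of_matching G f (aux_tutte G f heven (by
    intro S
    have h1 := h S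
    have h2 : ∑ v ∈ S, ((G.neighborSet v).ncard : ℤ) ≤ ∑ v ∈ S, ((f v : ℤ) + 2) :=
      Finset.sum_le_sum fun v _ => by exact_mod_cast hf2 v
    rw [Finset.sum_add_distrib, Finset.sum_const] at h2
    have h3 : ((∑ v ∈ S, f v : ℕ) : ℤ) = ∑ v ∈ S, (f v : ℤ) := by push_cast; rfl
    rw [nsmul_eq_mul] at h2
    omega))
  refine ⟨G \ H, sdiff_le, ?_, ?_, ?_⟩
  · intro v
    have h1 := aux_sdiff hHG v
    have h2 := (hH v).1
    have h3 := hf1 v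
    split_ifs at h3 <;> omega
  · intro v hv
    have h1 := aux_sdiff hHG v
    have h2 := hH v
    have h3 := hf1 v
    rw [if_pos hv] at h3
    simp only [Nat.odd_iff] at h2 ⊢
    omega
  · intro v hv
    have h1 := aux_sdiff hHG v
    have h2 := hH v
    have h3 := hf1 v
    rw [if_neg hv] at h3
    simp only [Nat.odd_iff, Nat.even_iff] at h2 ⊢
    omega

theorem aux_nec {V : Type*} [Fintype V] (G : SimpleGraph V) (h : HasStrongParityFactor G)
    (S : Finset V) :
    (Nat.card (G.induce ((S : Set V)ᶜ)).ConnectedComponent : ℤ) ≤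
          ∑ v ∈ S, ((G.neighborSet v).ncard : ℤ) - 2 * S.card + 1 := by
  classical
  let K := (G.induce ((S : Set V)ᶜ)).ConnectedComponent
  have : Fintype K := Fintype.ofFinite K
  change (Nat.card K : ℤ) ≤ _
  rw [Nat.card_eq_fintype_card]
  let comp : K → Finset V := fun c =>
    Finset.univ.filter fun v => ∃ hv : v ∈ ((S : Set V)ᶜ : Set V),
      SimpleGraph.connectedComponentMk (G.induce ((S : Set V)ᶜ)) ⟨v, hv⟩ = c
  have hrep : ∀ c : K, ∃ v, v ∈ comp c := by
    intro c
    induction c using SimpleGraph.ConnectedComponent.ind with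
    | h x => exact ⟨x, Finset.mem_filter.mpr ⟨Finset.mem_univ _, x.2, rfl⟩⟩
  choose r hr using hrep
  have huniq : ∀ c c' v, v ∈ comp c → v ∈ comp c' → c = c' := by
    intro c c' v hv hv'
    simp only [comp, Finset.mem_filter, Finset.mem_univ, true_and] at hv hv'
    obtain ⟨_, rfl⟩ := hv
    obtain ⟨_, rfl⟩ := hv'
    rfl
  have hnS : ∀ c v, v ∈ comp c → v ∉ S := by
    intro c v hv
    simp only [comp, Finset.mem_filter, Finset.mem_univ, true_and] at hv
    simpa using hv.1
  have hrinj : Function.Injective r := fun c c' hcc =>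
    huniq c c' (r c) (hr c) (hcc ▸ hr c')
  let R : Finset K := Finset.univ.filter fun c => Even (∑ v ∈ comp c, (G.neighborSet v).ncard)
  obtain ⟨R', hR'e, B, hB, hR'⟩ : ∃ R' : Finset K, Even R'.card ∧ ∃ B : Finset K, B.card ≤ 1 ∧
      ∀ c, c ∉ B → (c ∈ R' ↔ c ∈ R) := by
    rcases Nat.even_or_odd R.card with he | ho
    · exact ⟨R, he, ∅, by simp, fun _ _ => Iff.rfl⟩
    · obtain ⟨c0, hc0⟩ := Finset.card_pos.mp ho.pos
      refine ⟨R.erase c0, ?_, {c0}, by simp, ?_⟩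
      · rw [Finset.card_erase_of_mem hc0]
        exact Nat.Odd.sub_odd ho odd_one
      · intro c hc
        simp only [Finset.mem_singleton] at hc
        simp [hc]
  obtain ⟨F, hFG, hF1, hFo, hFe⟩ := h (R'.image r)
    (by rw [Finset.card_image_of_injective _ hrinj]; exact hR'e)
  have hSd : ∀ s ∈ S, ((G \ F).neighborSet s).ncard + 2 ≤ (G.neighborSet s).ncard := by
    intro s hs
    have h1 := aux_sdiff hFG s
    have h2 := hF1 s
    have h3 := hFe s (by
      intro hc
      obtain ⟨c, _, rfl⟩ := Finset.mem_image.mp hc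
      exact hnS c _ (hr c) hs)
    rw [Nat.even_iff] at h3
    omega
  have hodd : ∀ c, c ∉ B → Odd (∑ v ∈ comp c, ((G \ F).neighborSet v).ncard) := by
    intro c hc
    have h1 : ∑ v ∈ comp c, ((G \ F).neighborSet v).ncard + ∑ v ∈ comp c, (F.neighborSet v).ncard
        = ∑ v ∈ comp c, (G.neighborSet v).ncard := by
      rw [← Finset.sum_add_distrib]
      exact Finset.sum_congr rfl fun v _ => aux_sdiff hFG v
    have h2 : Odd (∑ v ∈ comp c, (F.neighborSet v).ncard) ↔ c ∈ R' := by
      rw [Finset.odd_sum_iff_odd_card_odd]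
      have h3 : ((comp c).filter fun v => Odd (F.neighborSet v).ncard)
          = if c ∈ R' then {r c} else ∅ := by
        ext v
        simp only [Finset.mem_filter]
        have hiff : Odd (F.neighborSet v).ncard ↔ v ∈ R'.image r := by
          constructor
          · intro ho
            by_contra hn
            exact (Nat.not_even_iff_odd.mpr ho) (hFe v hn)
          · exact hFo v
        rw [hiff, Finset.mem_image]
        split_ifs with hcR
        · rw [Finset.mem_singleton]
          constructor
          · rintro ⟨hv, c', _, rfl⟩
            rw [huniq c c' _ hv (hr c')]
          · rintro rfl
            exact ⟨hr c, c, hcR, rfl⟩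
        · simp only [Finset.notMem_empty, iff_false]
          rintro ⟨hv, c', hc', rfl⟩
          exact hcR (huniq c c' _ hv (hr c') ▸ hc')
      rw [h3]
      split_ifs with hcR <;> simp [hcR]
    rw [hR' c hc] at h2
    simp only [R, Finset.mem_filter, Finset.mem_univ, true_and] at h2
    rw [Nat.odd_iff, Nat.even_iff] at h2
    rw [Nat.odd_iff]
    omega
  have hedge : ∀ c, c ∉ B → ∃ x : Σ _ : V, V, x.1 ∈ S ∧ x.2 ∈ comp c ∧ (G \ F).Adj x.1 x.2 := by
    intro c hc
    obtain ⟨v, hv, w, hw, hvw⟩ := aux_leave (G \ F) (comp c) (hodd c hc)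
    refine ⟨⟨w, v⟩, ?_, hv, hvw.symm⟩
    by_contra hwS
    apply hw
    simp only [comp, Finset.mem_filter, Finset.mem_univ, true_and] at hv ⊢
    obtain ⟨hvS, rfl⟩ := hv
    refine ⟨by simpa using hwS, ?_⟩
    rw [SimpleGraph.ConnectedComponent.eq]
    apply SimpleGraph.Adj.reachable
    exact (sdiff_le (a := G) (b := F) hvw).symm
  have hcount : (Finset.univ \ B).card ≤ ∑ s ∈ S, ((G \ F).neighborSet s).ncard := by
    have h1 : (S.sigma fun s => ((G \ F).neighborSet s).toFinset).card
        = ∑ s ∈ S, ((G \ F).neighborSet s).ncard := by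
      rw [Finset.card_sigma]
      exact Finset.sum_congr rfl fun s _ => (Set.ncard_eq_toFinset_card' _).symm
    rw [← h1]
    refine Finset.card_le_card_of_injOn
      (fun c => if hc : c ∉ B then (hedge c hc).choose else ⟨r c, r c⟩) ?_ ?_
    · intro c hc
      have hc' : c ∉ B := by simpa using hc
      have := (hedge c hc').choose_spec
      simp only [hc', not_false_eq_true, dite_true]
      simp only [Finset.coe_sigma, Set.mem_sigma_iff, Finset.mem_coe, Set.mem_toFinset,
        SimpleGraph.mem_neighborSet]
      exact ⟨this.1, this.2.2⟩
    · intro c hc c' hc' heq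
      have hcB : c ∉ B := by simpa using hc
      have hcB' : c' ∉ B := by simpa using hc'
      simp only [hcB, hcB', not_false_eq_true, dite_true] at heq
      have h1 := (hedge c hcB).choose_spec.2.1
      have h2 := (hedge c' hcB').choose_spec.2.1
      rw [← heq] at h2
      exact huniq _ _ _ h1 h2
  have hcard : Fintype.card K ≤ (Finset.univ \ B).card + 1 := by
    have := Finset.card_le_card_sdiff_add_card (s := (Finset.univ : Finset K)) (t := B)
    rw [Finset.card_univ] at this
    omega
  have hfin : ∑ s ∈ S, ((G \ F).neighborSet s).ncard + 2 * S.card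
      ≤ ∑ s ∈ S, (G.neighborSet s).ncard := by
    rw [mul_comm, ← smul_eq_mul, ← Finset.sum_const, ← Finset.sum_add_distrib]
    exact Finset.sum_le_sum hSd
  have : ((∑ s ∈ S, (G.neighborSet s).ncard : ℕ) : ℤ) = ∑ s ∈ S, ((G.neighborSet s).ncard : ℤ) := by
    push_cast; rfl
  omega

/-- A graph `G` has a strong parity factor if and only if
`c(G−S) ≤ Σ_{v∈S} d_G(v) − 2|S| + 1` for every subset `S ⊆ V(G)`. -/
theorem stmt_1 {V : Type*} [Fintype V] (G : SimpleGraph V) :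
    HasStrongParityFactor G ↔
      ∀ S : Finset V,
        (Nat.card (G.induce ((S : Set V)ᶜ)).ConnectedComponent : ℤ) ≤
          ∑ v ∈ S, ((G.neighborSet v).ncard : ℤ) - 2 * S.card + 1 := by
  exact ⟨fun h S => aux_nec G h S, aux_suff G⟩
end

section
/- Let G be a connected graph with minimum degree δ. If G has no strong parity factor, then there exists a nonempty subset S ⊆ V(G) with c(G−S) ≥ Σ_{v∈S} d_G(v) − 2|S| + 2 ≥ (δ−2)|S| + 2. -/
open Finset

namespace SPF

/-- Deleting one edge creates at most one new component. -/
lemma card_cc_deleteEdge {W : Type*} [Finite W] (H : SimpleGraph W) (e : Sym2 W) :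
    Nat.card (H.deleteEdges {e}).ConnectedComponent ≤ Nat.card H.ConnectedComponent + 1 := by
  classical
  induction e using Sym2.ind with
  | _ a b =>
  set K := H.deleteEdges {s(a, b)} with hK
  have key : ∀ x y, H.Reachable x y → K.Reachable x y ∨
      ((K.Reachable x a ∨ K.Reachable x b) ∧ (K.Reachable y a ∨ K.Reachable y b)) := by
    rintro x y ⟨p⟩
    induction p with
    | nil => exact Or.inl (SimpleGraph.Reachable.refl _)
    | @cons u v w h p ih =>
      by_cases he : s(u, v) = s(a, b)
      · have huv : (K.Reachable u a ∨ K.Reachable u b) ∧ (K.Reachable v a ∨ K.Reachable v b) := by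
          rcases Sym2.eq_iff.1 he with ⟨rfl, rfl⟩ | ⟨rfl, rfl⟩
          · exact ⟨Or.inl (.refl _), Or.inr (.refl _)⟩
          · exact ⟨Or.inr (.refl _), Or.inl (.refl _)⟩
        rcases ih with h1 | h1
        · exact Or.inr ⟨huv.1, huv.2.imp (h1.symm.trans ·) (h1.symm.trans ·)⟩
        · exact Or.inr ⟨huv.1, h1.2⟩
      · have hadj : K.Adj u v := by
          rw [hK, SimpleGraph.deleteEdges_adj]
          exact ⟨h, by simpa using he⟩
        rcases ih with h1 | h1
        · exact Or.inl (hadj.reachable.trans h1)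
        · exact Or.inr ⟨h1.1.imp (hadj.reachable.trans ·) (hadj.reachable.trans ·), h1.2⟩
  let φ : K.ConnectedComponent → Option H.ConnectedComponent := fun c =>
    if c = K.connectedComponentMk b then none
    else some (c.map (SimpleGraph.Hom.ofLE (SimpleGraph.deleteEdges_le _)))
  have hφ : Function.Injective φ := by
    intro c c' h
    induction c using SimpleGraph.ConnectedComponent.ind with | _ x
    induction c' using SimpleGraph.ConnectedComponent.ind with | _ y
    simp only [φ] at h
    split_ifs at h with h1 h2 h2
    · exact h1.trans h2.symm
    · have h := SimpleGraph.ConnectedComponent.exact (Option.some_injective _ h)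
      rw [SimpleGraph.ConnectedComponent.eq] at h1 h2 ⊢
      rcases key x y h with h3 | ⟨h3, h4⟩
      · exact h3
      · exact (h3.resolve_right h1).trans (h4.resolve_right h2).symm
  have := Nat.card_le_card_of_injective φ hφ
  rwa [Finite.card_option] at this

lemma card_cc_deleteEdges {W : Type*} [Finite W] (H : SimpleGraph W) (A : Finset (Sym2 W)) :
    Nat.card (H.deleteEdges (A : Set (Sym2 W))).ConnectedComponent ≤
      Nat.card H.ConnectedComponent + A.card := by
  classical
  induction A using Finset.induction_on with
  | empty => simp
  | insert e A he ih =>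
    have h1 := card_cc_deleteEdge (H.deleteEdges (A : Set (Sym2 W))) e
    rw [SimpleGraph.deleteEdges_deleteEdges, Set.union_singleton] at h1
    rw [Finset.coe_insert, Finset.card_insert_of_notMem he]
    omega

section gadget

variable {V : Type*} (G : SimpleGraph V) (g : V → ℕ)

/-- Vertices of the gadget graph: darts of `G` and `g v` core vertices for every `v`. -/
abbrev GV := G.Dart ⊕ (Σ v : V, Fin (g v))

variable {G g}

/-- The vertex of `G` owning a gadget vertex. -/
def owner : GV G g → V
  | Sum.inl d => d.fst
  | Sum.inr s => s.1

variable (G g)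

/-- The gadget graph. -/
def gad : SimpleGraph (GV G g) where
  Adj x y := x ≠ y ∧ ((owner x = owner y ∧ (x.isLeft ∨ y.isLeft)) ∨
    ∃ d : G.Dart, x = Sum.inl d ∧ y = Sum.inl d.symm)
  symm := ⟨by
    rintro x y ⟨hne, h⟩
    refine ⟨hne.symm, ?_⟩
    rcases h with ⟨h1, h2⟩ | ⟨d, h1, h2⟩
    · exact Or.inl ⟨h1.symm, h2.symm⟩
    · exact Or.inr ⟨d.symm, h2, by rw [h1, SimpleGraph.Dart.symm_symm]⟩⟩
  loopless := ⟨fun x h => h.1 rfl⟩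

variable {G g}

/-- A perfect matching of the gadget graph gives a factor. -/
lemma factor_of_matching [Fintype V] (hg : ∀ v, 1 ≤ g v)
    (f : GV G g → GV G g) (hf : ∀ x, f (f x) = x) (hadj : ∀ x, (gad G g).Adj x (f x)) :
    ∃ F : SimpleGraph V, F ≤ G ∧ ∀ v, 1 ≤ (F.neighborSet v).ncard ∧
      Even ((F.neighborSet v).ncard + g v) := by
  classical
  let F : SimpleGraph V :=
    { Adj := fun u v => ∃ h : G.Adj u v,
        f (Sum.inl ⟨(u, v), h⟩) ≠ Sum.inl ⟨(v, u), h.symm⟩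
      symm := ⟨by
        rintro u v ⟨h, h1⟩
        refine ⟨h.symm, fun h2 => h1 ?_⟩
        rw [← h2, hf]⟩
      loopless := ⟨fun v h => G.irrefl h.1⟩ }
  refine ⟨F, fun u v h => h.1, fun v => ?_⟩
  have hdart : ∀ d : G.Dart, f (Sum.inl d) ≠ Sum.inl d.symm →
      owner (f (Sum.inl d)) = d.fst := by
    intro d hd
    rcases (hadj (Sum.inl d)).2 with ⟨h, -⟩ | ⟨d', h1, h2⟩
    · exact h.symm
    · cases Sum.inl_injective h1
      exact absurd h2 hd
  have hcore : ∀ s, owner (f (Sum.inr s)) = s.1 ∧ (f (Sum.inr s)).isLeft := by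
    intro s
    rcases (hadj (Sum.inr s)).2 with ⟨h, h'⟩ | ⟨d', h1, h2⟩
    · exact ⟨h.symm, by simpa using h'⟩
    · simp at h1
  let P : Finset (GV G g) := Finset.univ.filter fun x => owner x = v ∧ owner (f x) = v
  have hPeven : Even P.card := by
    have h0 : ∑ x ∈ P, (1 : ZMod 2) = 0 := by
      refine Finset.sum_involution (fun x _ => f x) ?_ ?_ ?_ ?_
      · intros; decide
      · intro x _ _; exact (hadj x).1.symm
      · intro x hx
        simp only [P, Finset.mem_filter, Finset.mem_univ, true_and] at hx ⊢
        rw [hf]; exact hx.symm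
      · intro x _; exact hf x
    rw [Finset.sum_const, nsmul_eq_mul, mul_one] at h0
    exact (ZMod.natCast_eq_zero_iff_even).1 h0
  let φ : F.neighborSet v ⊕ Fin (g v) → P := Sum.elim
    (fun w => ⟨Sum.inl ⟨(v, w.1), w.2.1⟩, by
      simp only [P, Finset.mem_filter, Finset.mem_univ, true_and]
      exact ⟨rfl, hdart _ w.2.2⟩⟩)
    (fun i => ⟨Sum.inr ⟨v, i⟩, by
      simp only [P, Finset.mem_filter, Finset.mem_univ, true_and]
      exact ⟨rfl, (hcore _).1⟩⟩)
  have hφ : Function.Bijective φ := by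
    constructor
    · rintro (⟨w, hw⟩ | i) (⟨w', hw'⟩ | i') h
      · simp only [φ, Sum.elim_inl, Subtype.mk.injEq, Sum.inl.injEq, SimpleGraph.Dart.mk.injEq,
          Prod.mk.injEq] at h
        simpa using h
      · simp [φ] at h
      · simp [φ] at h
      · simpa [φ] using h
    · rintro ⟨x, hx⟩
      simp only [P, Finset.mem_filter, Finset.mem_univ, true_and] at hx
      rcases x with ⟨⟨a, b⟩, hd⟩ | ⟨a, i⟩
      · obtain ⟨h1, h2⟩ := hx
        change a = v at h1
        subst h1
        refine ⟨Sum.inl ⟨b, hd, fun h => ?_⟩, rfl⟩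
        rw [h] at h2
        exact G.ne_of_adj hd h2.symm
      · obtain ⟨h1, h2⟩ := hx
        change a = v at h1
        subst h1
        exact ⟨Sum.inr i, rfl⟩
  have hcard : P.card = (F.neighborSet v).ncard + g v := by
    have := Nat.card_congr (Equiv.ofBijective φ hφ)
    rw [Nat.card_sum, Nat.card_coe_set_eq] at this
    simpa using this.symm
  refine ⟨?_, hcard ▸ hPeven⟩
  rw [Nat.one_le_iff_ne_zero]
  intro h0
  rw [Set.ncard_eq_zero] at h0
  have hc := hcore ⟨v, ⟨0, hg v⟩⟩
  rcases hx : f (Sum.inr ⟨v, ⟨0, hg v⟩⟩) with ⟨⟨a, b⟩, hd⟩ | s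
  · rw [hx] at hc
    have h1 : a = v := hc.1
    subst h1
    have : b ∈ F.neighborSet a := by
      refine ⟨hd, ?_⟩
      rw [← hx, hf]
      simp
    rw [h0] at this
    exact this
  · rw [hx] at hc; simp at hc

/-- Counting components of the gadget graph minus a set. -/
lemma violator_bound [Fintype V] [DecidableRel G.Adj] (U : Set (GV G g)) :
    ∃ T : Finset V,
      ∑ v ∈ T, G.degree v + Nat.card
        ((⊤ : (gad G g).Subgraph).deleteVerts U).coe.ConnectedComponent ≤
      U.ncard + ∑ v ∈ T, g v + Nat.card (G.induce ((T : Set V)ᶜ)).ConnectedComponent := by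
  classical
  let T : Finset V := Finset.univ.filter fun v => ∀ d : G.Dart, d.fst = v → Sum.inl d ∈ U
  have hT : ∀ v, v ∈ T ↔ ∀ d : G.Dart, d.fst = v → Sum.inl d ∈ U := by simp [T]
  refine ⟨T, ?_⟩
  let W := ((T : Set V)ᶜ : Set V)
  let H := G.induce W
  -- darts in U outside T
  let R : Finset G.Dart := Finset.univ.filter fun d => Sum.inl d ∈ U ∧ d.fst ∉ T
  let D : Finset G.Dart := Finset.univ.filter fun d => d.fst ∈ T
  let A : Finset (Sym2 W) := Finset.univ.filter fun e => ∃ d ∈ R, e.map Subtype.val = d.edge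
  have hA : A.card ≤ R.card := by
    have : ∀ e ∈ A, ∃ d ∈ R, e.map Subtype.val = d.edge := by
      intro e he; simpa [A] using he
    refine Finset.card_le_card_of_forall_subsingleton
      (fun e d => e.map Subtype.val = d.edge) this ?_
    intro d _ e he e' he'
    apply Sym2.map.injective Subtype.val_injective
    exact he.2.trans he'.2.symm
  have hD : D.card = ∑ v ∈ T, G.degree v := by
    rw [Finset.card_eq_sum_card_fiberwise (f := fun d : G.Dart => d.fst) (t := T)]
    · refine Finset.sum_congr rfl fun v hv => ?_
      rw [← G.dart_fst_fiber_card_eq_degree v]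
      congr 1
      ext d
      simp only [D, Finset.mem_filter, Finset.mem_univ, true_and]
      constructor
      · exact fun h => h.2
      · exact fun h => ⟨h ▸ hv, h⟩
    · intro d hd
      simpa [D] using hd
  have hDR : D.card + R.card ≤ U.ncard := by
    have hdisj : Disjoint D R := by
      rw [Finset.disjoint_left]
      intro d h1 h2
      simp only [D, R, Finset.mem_filter, Finset.mem_univ, true_and] at h1 h2
      exact h2.2 h1
    rw [← Finset.card_union_of_disjoint hdisj,
      ← Finset.card_image_of_injective _ (Sum.inl_injective (β := Σ v : V, Fin (g v))),
      ← Set.ncard_coe_finset]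
    refine Set.ncard_le_ncard ?_ (Set.toFinite _)
    intro x hx
    simp only [Finset.coe_image, Set.mem_image, Finset.mem_coe, Finset.mem_union] at hx
    obtain ⟨d, hd, rfl⟩ := hx
    rcases hd with hd | hd
    · simp only [D, Finset.mem_filter, Finset.mem_univ, true_and] at hd
      exact (hT _).1 hd d rfl
    · simp only [R, Finset.mem_filter, Finset.mem_univ, true_and] at hd
      exact hd.1
  let K := H.deleteEdges (A : Set (Sym2 W))
  have hK := card_cc_deleteEdges H A
  let Q := ((⊤ : (gad G g).Subgraph).deleteVerts U)
  have hQadj : ∀ x y : Q.verts, (gad G g).Adj x y → Q.coe.Adj x y := by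
    intro x y h
    have hx := x.2; have hy := y.2
    simp only [Q, SimpleGraph.Subgraph.deleteVerts_verts, SimpleGraph.Subgraph.verts_top,
      Set.mem_sdiff, Set.mem_univ, true_and] at hx hy
    simp only [Q, SimpleGraph.Subgraph.coe_adj, SimpleGraph.Subgraph.deleteVerts_adj,
      SimpleGraph.Subgraph.verts_top, Set.mem_univ, true_and, SimpleGraph.Subgraph.top_adj]
    exact ⟨hx, hy, h⟩
  have hQU : ∀ x : Q.verts, x.1 ∉ U := by
    intro x
    have hx := x.2
    simp only [Q, SimpleGraph.Subgraph.deleteVerts_verts, SimpleGraph.Subgraph.verts_top,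
      Set.mem_sdiff, Set.mem_univ, true_and] at hx
    exact hx
  have hmem : ∀ x, x ∉ U → x ∈ Q.verts := by
    intro x hx
    simp only [Q, SimpleGraph.Subgraph.deleteVerts_verts, SimpleGraph.Subgraph.verts_top,
      Set.mem_sdiff, Set.mem_univ, true_and]
    exact hx
  have hgadconn : ∀ x y : Q.verts, owner x.1 = owner y.1 → owner x.1 ∉ T →
      Q.coe.Reachable x y := by
    intro x y hxy hx
    have : ∃ d : G.Dart, d.fst = owner x.1 ∧ Sum.inl d ∉ U := by
      rw [hT] at hx; push Not at hx; exact hx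
    obtain ⟨d, hd, hdU⟩ := this
    have hh : ∀ z : Q.verts, owner z.1 = owner x.1 →
        Q.coe.Reachable z ⟨Sum.inl d, hmem _ hdU⟩ := by
      intro z hz
      by_cases hzd : z.1 = Sum.inl d
      · have : z = ⟨Sum.inl d, hmem _ hdU⟩ := Subtype.ext hzd
        rw [this]
      · refine (hQadj _ _ ⟨hzd, Or.inl ⟨?_, Or.inr rfl⟩⟩).reachable
        rw [hz, ← hd]; rfl
    exact (hh x rfl).trans (hh y hxy.symm).symm
  have hreach : ∀ v w : W, K.Reachable v w → ∀ x y : Q.verts, owner x.1 = v → owner y.1 = w →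
      Q.coe.Reachable x y := by
    rintro v w ⟨p⟩
    induction p with
    | @nil u =>
      intro x y hx hy
      exact hgadconn x y (hx.trans hy.symm) (hx ▸ u.2)
    | @cons u v w h p ih =>
      intro x y hx hy
      rw [SimpleGraph.deleteEdges_adj] at h
      obtain ⟨h1, h2⟩ := h
      have h1' : G.Adj u.1 v.1 := h1
      have hnot : ∀ d ∈ R, s(u.1, v.1) ≠ d.edge := by
        intro d hd he
        apply h2
        simp only [A, Finset.coe_filter, Finset.mem_univ, true_and, Set.mem_ofPred_eq]
        exact ⟨d, hd, by simpa using he⟩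
      let d : G.Dart := ⟨(u.1, v.1), h1'⟩
      have hdU : Sum.inl d ∉ U := by
        intro hd
        refine hnot d ?_ rfl
        simp only [R, Finset.mem_filter, Finset.mem_univ, true_and]
        exact ⟨hd, u.2⟩
      have hdU' : Sum.inl d.symm ∉ U := by
        intro hd
        refine hnot d.symm ?_ (by rw [SimpleGraph.Dart.edge_symm]; rfl)
        simp only [R, Finset.mem_filter, Finset.mem_univ, true_and]
        exact ⟨hd, v.2⟩
      have r1 := hgadconn x ⟨Sum.inl d, hmem _ hdU⟩ hx (hx ▸ u.2)
      have r2 : Q.coe.Adj ⟨Sum.inl d, hmem _ hdU⟩ ⟨Sum.inl d.symm, hmem _ hdU'⟩ := by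
        refine hQadj _ _ ⟨?_, Or.inr ⟨d, rfl, rfl⟩⟩
        intro h
        exact d.symm_ne (Sum.inl_injective h).symm
      exact (r1.trans r2.reachable).trans (ih ⟨Sum.inl d.symm, hmem _ hdU'⟩ y rfl hy)
  have hcoreT : ∀ x : Q.verts, owner x.1 ∈ T → ∃ v : T, ∃ i : Fin (g v), x.1 = Sum.inr ⟨v, i⟩ := by
    rintro ⟨x, hx⟩ h
    rcases x with d | ⟨v, i⟩
    · exact absurd ((hT _).1 h d rfl) (hQU ⟨_, hx⟩)
    · exact ⟨⟨v, h⟩, i, rfl⟩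
  choose cv ci hci using hcoreT
  let φ : Q.verts → (Σ v : T, Fin (g v)) ⊕ K.ConnectedComponent := fun x =>
    if h : owner x.1 ∈ T then Sum.inl ⟨cv x h, ci x h⟩
    else Sum.inr (K.connectedComponentMk ⟨owner x.1, h⟩)
  have hφ : ∀ x y, φ x = φ y → Q.coe.Reachable x y := by
    intro x y h
    simp only [φ] at h
    split_ifs at h with h1 h2 h2
    · have h3 := Sum.inl_injective h
      have : x = y := by
        apply Subtype.ext
        rw [hci x h1, hci y h2]
        exact congrArg (fun s : (Σ v : T, Fin (g v)) => (Sum.inr ⟨s.1.1, s.2⟩ : GV G g)) h3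
      rw [this]
    · have h3 := Sum.inr_injective h
      rw [SimpleGraph.ConnectedComponent.eq] at h3
      exact hreach _ _ h3 x y rfl rfl
  have hinj : Function.Injective fun c : Q.coe.ConnectedComponent => φ c.out := by
    intro c c' h
    have := hφ _ _ h
    rw [← SimpleGraph.ConnectedComponent.eq] at this
    exact (Quot.out_eq c).symm.trans (this.trans (Quot.out_eq c'))
  have hle := Nat.card_le_card_of_injective _ hinj
  rw [Nat.card_sum] at hle
  have hs : Nat.card (Σ v : T, Fin (g v)) = ∑ v ∈ T, g v := by
    rw [Nat.card_eq_fintype_card, Fintype.card_sigma]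
    simp only [Fintype.card_fin]
    exact Finset.sum_coe_sort T g
  rw [hs] at hle
  change _ + Nat.card Q.coe.ConnectedComponent ≤ _ + _ + Nat.card H.ConnectedComponent
  have hK' : Nat.card K.ConnectedComponent ≤ Nat.card H.ConnectedComponent + A.card := hK
  omega

end gadget

end SPF

theorem stmt_5 {V : Type*} [Fintype V] (G : SimpleGraph V) [DecidableRel G.Adj]
    (hconn : G.Connected) (hno : ¬ HasStrongParityFactor G) :
    ∃ S : Finset V, S.Nonempty ∧
      (∑ v ∈ S, (G.degree v : ℤ) - 2 * S.card + 2 ≤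
        (Nat.card (G.induce ((S : Set V)ᶜ)).ConnectedComponent : ℤ)) ∧
      ((G.minDegree : ℤ) - 2) * S.card + 2 ≤
        ∑ v ∈ S, (G.degree v : ℤ) - 2 * S.card + 2 := by
  classical
  unfold HasStrongParityFactor at hno
  push Not at hno
  obtain ⟨X, hX, hno⟩ := hno
  let g : V → ℕ := fun v => if v ∈ X then 1 else 2
  have hg1 : ∀ v, 1 ≤ g v := by intro v; simp only [g]; split_ifs <;> omega
  have hg2 : ∀ v, g v ≤ 2 := by intro v; simp only [g]; split_ifs <;> omega
  have hgodd : ∀ v, v ∈ X → g v = 1 := by intro v h; simp [g, h]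
  have hgeven : ∀ v, v ∉ X → g v = 2 := by intro v h; simp [g, h]
  -- no perfect matching in the gadget graph
  have hnoM : ∀ M : (SPF.gad G g).Subgraph, ¬ M.IsPerfectMatching := by
    intro M hM
    have hM' := SimpleGraph.Subgraph.isPerfectMatching_iff.1 hM
    choose f hf hf' using hM'
    obtain ⟨F, hFG, hF⟩ := SPF.factor_of_matching hg1 f
      (fun x => (hf' (f x) x (hf x).symm).symm) (fun x => (hf x).adj_sub)
    obtain ⟨v, hv, hv'⟩ := hno F hFG (fun v => (hF v).1) (by
      intro u hu
      have := (hF u).2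
      rw [hgodd u hu] at this
      rw [Nat.even_add_one, Nat.not_even_iff_odd] at this
      exact this)
    have := (hF v).2
    rw [hgeven v hv, Nat.even_add] at this
    exact (Nat.not_even_iff_odd.2 (by simpa using hv')) (this.2 (by decide))
  have hcardeven : Even (Nat.card (SPF.GV G g)) := by
    rw [Nat.card_eq_fintype_card, Fintype.card_sum, G.dart_card_eq_twice_card_edges,
      Fintype.card_sigma]
    simp only [Fintype.card_fin]
    have : ∑ v, g v + X.card = 2 * Fintype.card V := by
      have : X.card = ∑ v, if v ∈ X then 1 else 0 := by simp
      rw [this, ← Finset.sum_add_distrib]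
      rw [Finset.sum_congr rfl (g := fun _ => 2)]
      · simp [mul_comm]
      · intro v _; simp only [g]; split_ifs <;> rfl
    obtain ⟨k, hk⟩ := hX
    rw [Nat.even_iff]
    omega
  obtain ⟨U, hU⟩ := SimpleGraph.exists_isTutteViolator hnoM hcardeven
  unfold SimpleGraph.IsTutteViolator at hU
  obtain ⟨T, hT⟩ := SPF.violator_bound (G := G) (g := g) U
  set Q := ((⊤ : (SPF.gad G g).Subgraph).deleteVerts U) with hQ
  have hodd : Q.coe.oddComponents.ncard ≤ Nat.card Q.coe.ConnectedComponent := by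
    rw [← Set.ncard_univ]
    exact Set.ncard_le_ncard (Set.subset_univ _) (Set.toFinite _)
  have hpar : U.ncard + 2 ≤ Q.coe.oddComponents.ncard := by
    have h1 := Q.coe.odd_ncard_oddComponents
    have h2 : Nat.card Q.verts + U.ncard = Nat.card (SPF.GV G g) := by
      have : Q.verts = Uᶜ := by
        rw [hQ, SimpleGraph.Subgraph.deleteVerts_verts, SimpleGraph.Subgraph.verts_top,
          Set.compl_eq_univ_sdiff]
      rw [this, Nat.card_coe_set_eq, add_comm]
      exact Set.ncard_add_ncard_compl U
    rw [Nat.odd_iff, Nat.odd_iff] at h1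
    rw [Nat.even_iff] at hcardeven
    omega
  have hgT : ∑ v ∈ T, g v ≤ 2 * T.card := by
    calc ∑ v ∈ T, g v ≤ ∑ v ∈ T, 2 := Finset.sum_le_sum fun v _ => hg2 v
      _ = 2 * T.card := by simp [mul_comm]
  have hmain : ∑ v ∈ T, G.degree v + 2 ≤
      2 * T.card + Nat.card (G.induce ((T : Set V)ᶜ)).ConnectedComponent := by omega
  refine ⟨T, ?_, ?_, ?_⟩
  · rw [Finset.nonempty_iff_ne_empty]
    intro hT0
    rw [hT0] at hmain
    have hc : (G.induce (((∅ : Finset V) : Set V)ᶜ)).Preconnected := by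
      rintro ⟨x, hx⟩ ⟨y, hy⟩
      exact (hconn.preconnected x y).map
        (⟨fun v => ⟨v, by simp⟩, fun h => h⟩ : G →g G.induce (((∅ : Finset V) : Set V)ᶜ))
    have hs := hc.subsingleton_connectedComponent
    have := Finite.card_le_one_iff_subsingleton.2 hs
    simp only [Finset.sum_empty, Finset.card_empty] at hmain
    omega
  · have : ((∑ v ∈ T, G.degree v : ℕ) : ℤ) = ∑ v ∈ T, (G.degree v : ℤ) := by push_cast; rfl
    rw [← this]
    omega
  · have : ∑ v ∈ T, (G.minDegree : ℤ) ≤ ∑ v ∈ T, (G.degree v : ℤ) :=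
      Finset.sum_le_sum fun v _ => by exact_mod_cast G.minDegree_le_degree v
    rw [Finset.sum_const, nsmul_eq_mul] at this
    linarith
end
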